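/- arXiv:1301.4692 — 2 statements merged into one kernel-verified Lean document; each statement's English description precedes it below -/
import Mathlib

section
/- Let L be a domain and let E be a quasisober topological space. An L-valued maxitive measure ν on the Borel σ-algebra ℬ of E has a cardinal density if and only if ν is completely maxitive. -/
open Set

universe u v

section OrderDefs
variable {L : Type u} [PartialOrder L]

/-- A filtered (nonempty, downward directed) subset of a poset. -/
def DirFiltered (F : Set L) : Prop :=
  F.Nonempty ∧ ∀ r ∈ F, ∀ s ∈ F, ∃ t ∈ F, t ≤ r ∧ t ≤ s

/-- A filter of a poset: a filtered upper set. -/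
def OrdFilter (F : Set L) : Prop :=
  DirFiltered F ∧ ∀ r ∈ F, ∀ s : L, r ≤ s → s ∈ F

/-- Every filter has an infimum. -/
def FilteredComplete (L : Type u) [PartialOrder L] : Prop :=
  ∀ F : Set L, OrdFilter F → ∃ i : L, IsGLB F i

/-- `s` is way-above `r`: for every filter `F` with an infimum below `r`, `s ∈ F`. -/
def WayAbove (s r : L) : Prop :=
  ∀ F : Set L, OrdFilter F → ∀ i : L, IsGLB F i → i ≤ r → s ∈ F

/-- The poset is continuous: for every `r`, the set of elements way-above `r`
is a filter whose infimum is `r`. -/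
def ContinuousPoset (L : Type u) [PartialOrder L] : Prop :=
  ∀ r : L, OrdFilter {s : L | WayAbove s r} ∧ IsGLB {s : L | WayAbove s r} r

/-- Conditional completeness: every nonempty set bounded above has a supremum. -/
def CondComplete (L : Type u) [PartialOrder L] : Prop :=
  ∀ S : Set L, S.Nonempty → BddAbove S → ∃ m : L, IsLUB S m

end OrderDefs

/-- A domain: a filtered-complete continuous poset with a least element. -/
def DomainPoset (L : Type u) [PartialOrder L] [OrderBot L] : Prop :=
  FilteredComplete L ∧ ContinuousPoset L

section TopDefs
variable {E : Type v} [TopologicalSpace E]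

/-- The saturation of a set: intersection of all open sets containing it. -/
def satur (A : Set E) : Set E := ⋂₀ {G : Set E | IsOpen G ∧ A ⊆ G}

/-- A set is saturated if it is an intersection of open sets. -/
def IsSatur (A : Set E) : Prop :=
  ∃ 𝒢 : Set (Set E), (∀ G ∈ 𝒢, IsOpen G) ∧ A = ⋂₀ 𝒢

/-- The collection 𝒬 of compact saturated subsets. -/
def CompactSat (E : Type v) [TopologicalSpace E] : Set (Set E) :=
  {A : Set E | IsCompact A ∧ IsSatur A}

/-- The Borel σ-algebra generated by open sets and compact saturated sets. -/
def BorelM (E : Type v) [TopologicalSpace E] : MeasurableSpace E :=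
  MeasurableSpace.generateFrom ({A : Set E | IsOpen A} ∪ CompactSat E)

/-- Borel subsets for the σ-algebra generated by opens and compact saturated sets. -/
def IsBorelSet (B : Set E) : Prop := @MeasurableSet E (BorelM E) B

/-- The collection 𝒦 of compact Borel subsets. -/
def CompactBorel (E : Type v) [TopologicalSpace E] : Set (Set E) :=
  {A : Set E | IsBorelSet A ∧ IsCompact A}

/-- `[x]` : the compact Borel set `↑{x} ∩ closure {x}`. -/
def ptClass (x : E) : Set E := satur {x} ∩ closure {x}

end TopDefs

section MeasDefs
variable {L : Type u} {E : Type v} [PartialOrder L] [OrderBot L] [TopologicalSpace E]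

/-- An L-valued maxitive measure on the Borel σ-algebra. -/
def Maxitive (ν : Set E → L) : Prop :=
  ν ∅ = ⊥ ∧ ∀ 𝒞 : Set (Set E), 𝒞.Finite → (∀ B ∈ 𝒞, IsBorelSet B) →
    IsLUB (ν '' 𝒞) (ν (⋃₀ 𝒞))

/-- σ-maxitivity. -/
def SigmaMaxitive (ν : Set E → L) : Prop :=
  Maxitive ν ∧ ∀ 𝒞 : Set (Set E), 𝒞.Countable → (∀ B ∈ 𝒞, IsBorelSet B) →
    IsLUB (ν '' 𝒞) (ν (⋃₀ 𝒞))

/-- Complete maxitivity. -/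
def CompletelyMaxitive (ν : Set E → L) : Prop :=
  Maxitive ν ∧ ∀ 𝒞 : Set (Set E), (∀ B ∈ 𝒞, IsBorelSet B) → IsBorelSet (⋃₀ 𝒞) →
    IsLUB (ν '' 𝒞) (ν (⋃₀ 𝒞))

/-- The set `{ν G : G open, G ⊇ B}`. -/
def outerVals (ν : Set E → L) (B : Set E) : Set L :=
  {l : L | ∃ G : Set E, IsOpen G ∧ B ⊆ G ∧ ν G = l}

/-- `νp` is the map `ν⁺ : B ↦ inf {ν G : G open, G ⊇ B}` on Borel sets. -/
def IsNuPlus (ν νp : Set E → L) : Prop :=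
  ∀ B : Set E, IsBorelSet B → IsGLB (outerVals ν B) (νp B)

/-- Outer-continuity. -/
def OuterContinuous (ν : Set E → L) : Prop :=
  ∀ B : Set E, IsBorelSet B → IsGLB (outerVals ν B) (ν B)

/-- Inner-continuity. -/
def InnerContinuous (ν : Set E → L) : Prop :=
  ∀ B : Set E, IsBorelSet B →
    IsLUB {l : L | ∃ K : Set E, IsBorelSet K ∧ IsCompact K ∧ K ⊆ B ∧ ν (satur K) = l} (ν B)

/-- Regularity: inner- and outer-continuity. -/
def RegularMeasure (ν : Set E → L) : Prop :=
  InnerContinuous ν ∧ OuterContinuous ν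

/-- Weak outer-continuity: `ν K = ν⁺ K` for every compact Borel `K`. -/
def WeaklyOuterContinuous (ν : Set E → L) : Prop :=
  ∀ K : Set E, IsBorelSet K → IsCompact K → IsGLB (outerVals ν K) (ν K)

/-- Weak inner-continuity (relative to a given `ν⁺ = νp`). -/
def WeaklyInnerContinuous (ν νp : Set E → L) : Prop :=
  ∀ G : Set E, IsOpen G →
    IsLUB {l : L | ∃ K : Set E, IsBorelSet K ∧ IsCompact K ∧ K ⊆ G ∧ νp K = l} (ν G)

/-- 𝒜-smoothness. -/
def SmoothWrt (ν : Set E → L) (𝒜 : Set (Set E)) : Prop :=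
  ∀ 𝒟 : Set (Set E), 𝒟.Nonempty → 𝒟 ⊆ 𝒜 → DirectedOn (· ⊇ ·) 𝒟 →
    IsGLB (ν '' 𝒟) (ν (⋂₀ 𝒟))

/-- Saturation of a maxitive measure: `ν K = ν (↑K)` for compact Borel `K`. -/
def SaturatedMeasure (ν : Set E → L) : Prop :=
  ∀ K : Set E, IsBorelSet K → IsCompact K → ν K = ν (satur K)

/-- Tightness: `inf {ν (E ∖ K) : K compact Borel} = 0`. -/
def TightMeasure (ν : Set E → L) : Prop :=
  IsGLB {l : L | ∃ K : Set E, IsBorelSet K ∧ IsCompact K ∧ ν Kᶜ = l} (⊥ : L)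

/-- `c` is a cardinal density of `ν`. -/
def IsCardinalDensity (ν : Set E → L) (c : E → L) : Prop :=
  ∀ B : Set E, IsBorelSet B → IsLUB (c '' B) (ν B)

/-- Upper semicontinuity of a map into the poset. -/
def UscMap (c : E → L) : Prop := ∀ t : L, IsOpen {x : E | WayAbove t (c x)}

/-- Upper compactness of a map into the poset. -/
def UpperCompactMap (c : E → L) : Prop :=
  ∀ t : L, WayAbove t (⊥ : L) → IsCompact {x : E | ¬ WayAbove t (c x)}

/-- Continuity from above along decreasing sequences of Borel sets. -/
def ContinuousFromAbove (ν : Set E → L) : Prop :=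
  ∀ B : ℕ → Set E, (∀ n, IsBorelSet (B n)) → (∀ n, B (n + 1) ⊆ B n) →
    IsGLB (Set.range fun n => ν (B n)) (ν (⋂ n, B n))

/-- An optimal measure: a σ-maxitive measure continuous from above. -/
def OptimalMeasure (ν : Set E → L) : Prop :=
  SigmaMaxitive ν ∧ ContinuousFromAbove ν

/-- `flo` is the regular part `⌊ν⌋` (relative to `νp = ν⁺`):
`⌊ν⌋(B) = sup {ν⁺(K) : K compact Borel, K ⊆ B}`. -/
def RegPartRel (νp flo : Set E → L) : Prop :=
  ∀ B : Set E, IsBorelSet B →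
    IsLUB {l : L | ∃ K : Set E, IsBorelSet K ∧ IsCompact K ∧ K ⊆ B ∧ νp K = l} (flo B)

end MeasDefs

section BorelClasses
variable {E : Type v} [TopologicalSpace E]

theorem mem_ptClass_self (x : E) : x ∈ ptClass x :=
  ⟨fun _ hG => hG.2 rfl, subset_closure rfl⟩

theorem inseparable_of_mem_ptClass {x y : E} (hy : y ∈ ptClass x) : Inseparable x y := by
  refine inseparable_iff_forall_isOpen.2 fun G hG =>
    ⟨fun hx => hy.1 G ⟨hG, singleton_subset_iff.2 hx⟩, fun hyG => ?_⟩
  obtain ⟨z, hzG, rfl⟩ := mem_closure_iff.1 hy.2 G hG hyG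
  exact hzG

theorem isCompact_satur_singleton (x : E) : IsCompact (satur {x}) := by
  refine isCompact_of_finite_subcover fun {ι} U hU hcover => ?_
  obtain ⟨i, hi⟩ := mem_iUnion.1 (hcover fun G hG => hG.2 rfl : x ∈ ⋃ i, U i)
  exact ⟨{i}, fun y hy => mem_iUnion₂.2
    ⟨i, Finset.mem_singleton_self i, hy (U i) ⟨hU i, singleton_subset_iff.2 hi⟩⟩⟩

theorem isBorelSet_ptClass (x : E) : IsBorelSet (ptClass x) := by
  have hsat : @MeasurableSet E (BorelM E) (satur {x}) :=
    MeasurableSpace.measurableSet_generateFrom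
      (Or.inr ⟨isCompact_satur_singleton x, _, fun _ hG => hG.1, rfl⟩)
  have hopen : @MeasurableSet E (BorelM E) (closure {x})ᶜ :=
    MeasurableSpace.measurableSet_generateFrom (Or.inl isClosed_closure.isOpen_compl)
  exact @MeasurableSet.inter E (BorelM E) _ _ hsat
    ((@MeasurableSet.compl_iff E _ (BorelM E)).1 hopen)

/-- Borel sets do not separate topologically indistinguishable points. -/
theorem IsBorelSet.mem_iff_of_inseparable {B : Set E} (hB : IsBorelSet B) {x y : E}
    (h : Inseparable x y) : x ∈ B ↔ y ∈ B := by
  refine MeasurableSpace.generateFrom_induction _ (fun s _ => x ∈ s ↔ y ∈ s) ?_ Iff.rfl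
    (fun _ _ ih => not_congr ih) (fun f _ ih => ?_) B hB
  · rintro s (hs | ⟨-, 𝒢, h𝒢, rfl⟩) -
    · exact h.mem_open_iff hs
    · exact forall₂_congr fun G hG => h.mem_open_iff (h𝒢 G hG)
  · simp only [mem_iUnion, ih]

theorem IsBorelSet.sUnion_image_ptClass {B : Set E} (hB : IsBorelSet B) :
    ⋃₀ (ptClass '' B) = B := by
  ext y
  simp only [sUnion_image, mem_iUnion, exists_prop]
  exact ⟨fun ⟨_, hx, hy⟩ => (hB.mem_iff_of_inseparable (inseparable_of_mem_ptClass hy)).1 hx,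
    fun hy => ⟨y, hy, mem_ptClass_self y⟩⟩

end BorelClasses

section Density
variable {L : Type u} {E : Type v} [PartialOrder L] [TopologicalSpace E]
  {ν : Set E → L}

theorem IsCardinalDensity.isLUB_sUnion {c : E → L} (hc : IsCardinalDensity ν c)
    {𝒞 : Set (Set E)} (h𝒞 : ∀ B ∈ 𝒞, IsBorelSet B) (hU : IsBorelSet (⋃₀ 𝒞)) :
    IsLUB (ν '' 𝒞) (ν (⋃₀ 𝒞)) := by
  refine ⟨?_, fun b hb => (hc _ hU).2 ?_⟩
  · rintro _ ⟨B, hB, rfl⟩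
    exact (hc B (h𝒞 B hB)).mono (hc _ hU) (image_mono (subset_sUnion_of_mem hB))
  · rintro _ ⟨x, ⟨B, hB, hx⟩, rfl⟩
    exact ((hc B (h𝒞 B hB)).1 (mem_image_of_mem c hx)).trans (hb (mem_image_of_mem ν hB))

theorem CompletelyMaxitive.isCardinalDensity [OrderBot L] (h : CompletelyMaxitive ν) :
    IsCardinalDensity ν fun x => ν (ptClass x) := by
  intro B hB
  have key := h.2 (ptClass '' B) (forall_mem_image.2 fun x _ => isBorelSet_ptClass x)
    (hB.sUnion_image_ptClass.symm ▸ hB)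
  rwa [hB.sUnion_image_ptClass, image_image] at key

end Density

/-- On a quasisober space, an L-valued maxitive measure (L a domain)
has a cardinal density iff it is completely maxitive. -/
theorem stmt0 {L : Type u} {E : Type v} [PartialOrder L] [OrderBot L]
    [TopologicalSpace E] [QuasiSober E] (hL : DomainPoset L)
    (ν : Set E → L) (hν : Maxitive ν) :
    (∃ c : E → L, IsCardinalDensity ν c) ↔ CompletelyMaxitive ν := by
  exact ⟨fun ⟨_, hc⟩ => ⟨hν, fun _ h𝒞 hU => hc.isLUB_sUnion h𝒞 hU⟩,
    fun h => ⟨_, h.isCardinalDensity⟩⟩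
end

section
/- Let L be a continuous conditionally-complete distributive lattice and let E be a metrizable topological space. Every L-valued optimal measure ν on the Borel σ-algebra ℬ of E can be decomposed as ν(B) = ⌊ν⌋(B) ⊔ ⊥ν(B) for all B ∈ ℬ, where the regular part ⌊ν⌋ is a regular optimal measure and the singular part ⊥ν is an optimal measure satisfying ⊥ν(K) = 0 for every compact Borel set K. -/
open Set

universe u v

section WayAboveLemmas
variable {L : Type u}

theorem WayAbove.le [PartialOrder L] {s r : L} (h : WayAbove s r) : r ≤ s :=
  h (Ici r) ⟨⟨nonempty_Ici, fun _ ha _ hb => ⟨r, le_rfl, ha, hb⟩⟩,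
    fun _ ha _ hab => le_trans ha hab⟩ r isGLB_Ici le_rfl

theorem WayAbove.mono_right [PartialOrder L] {s r r' : L} (h : WayAbove s r) (hr : r' ≤ r) :
    WayAbove s r' :=
  fun F hF i hi hir => h F hF i hi (hir.trans hr)

/-- In a continuous lattice, binary joins distribute over infima of filters. -/
theorem ContinuousPoset.le_sup_of_forall_mem [Lattice L] (hcont : ContinuousPoset L)
    {F : Set L} (hF : OrdFilter F) {a b i : L} (hi : IsGLB F i) (h : ∀ f ∈ F, a ≤ b ⊔ f) :
    a ≤ b ⊔ i := by
  refine (hcont (b ⊔ i)).2.2 fun t ht => ?_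
  have htF : t ∈ F := WayAbove.mono_right ht le_sup_right F hF i hi le_rfl
  exact (h t htF).trans (sup_le (le_sup_left.trans (WayAbove.le ht)) le_rfl)

theorem ContinuousPoset.le_of_forall_wayAbove_bot [Lattice L] [OrderBot L]
    (hcont : ContinuousPoset L) {a b : L} (h : ∀ s, WayAbove s (⊥ : L) → a ≤ b ⊔ s) :
    a ≤ b := by
  simpa using hcont.le_sup_of_forall_mem (hcont ⊥).1 (hcont ⊥).2 h

/-- Continuous conditionally-complete distributive lattices have relative differences. -/
theorem exists_forall_le_sup_iff [Lattice L] [OrderBot L] (hcc : CondComplete L)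
    (hcont : ContinuousPoset L) (hdist : ∀ a b c : L, a ⊓ (b ⊔ c) = a ⊓ b ⊔ a ⊓ c) (a b : L) :
    ∃ d : L, ∀ c : L, d ≤ c ↔ a ≤ b ⊔ c := by
  let _ : DistribLattice L := DistribLattice.ofInfSupLe fun _ _ _ => (hdist _ _ _).le
  have hF : OrdFilter {c : L | a ≤ b ⊔ c} := by
    refine ⟨⟨⟨a, le_sup_right⟩, fun r hr s hs => ⟨r ⊓ s, ?_, inf_le_left, inf_le_right⟩⟩,
      fun r hr s hrs => le_trans hr (sup_le_sup_left hrs b)⟩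
    change a ≤ b ⊔ r ⊓ s
    rw [sup_inf_left]
    exact le_inf hr hs
  obtain ⟨d, hd⟩ := hcc (lowerBounds {c : L | a ≤ b ⊔ c}) ⟨⊥, fun _ _ => bot_le⟩
    ⟨a, fun x hx => hx (show a ≤ b ⊔ a from le_sup_right)⟩
  have hd' : IsGLB {c : L | a ≤ b ⊔ c} d := isLUB_lowerBounds.1 hd
  have had : a ≤ b ⊔ d := hcont.le_sup_of_forall_mem hF hd' fun _ h => h
  exact ⟨d, fun c => ⟨fun h => had.trans (sup_le_sup_left h b), fun h => hd'.1 h⟩⟩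

end WayAboveLemmas

section BorelLemmas
variable {E : Type v} [TopologicalSpace E]

theorem satur_eq_self [T1Space E] (A : Set E) : satur A = A := by
  refine Subset.antisymm (fun x hx => ?_) fun x hx G hG => hG.2 hx
  by_contra hxA
  exact hx {x}ᶜ ⟨isOpen_compl_singleton, fun y hy hyx => hxA (hyx ▸ hy)⟩ rfl

theorem borelM_eq_borel [T2Space E] : BorelM E = borel E := by
  refine le_antisymm (MeasurableSpace.generateFrom_le ?_)
    (MeasurableSpace.generateFrom_mono subset_union_left)
  rintro A (hA | hA)
  · exact MeasurableSpace.measurableSet_generateFrom hA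
  · rw [← compl_compl A]
    exact (MeasurableSpace.measurableSet_generateFrom (s := {s | IsOpen s})
      hA.1.isClosed.isOpen_compl).compl

theorem IsOpen.isBorelSet {A : Set E} (hA : IsOpen A) : IsBorelSet A :=
  MeasurableSpace.measurableSet_generateFrom (Or.inl hA)

theorem IsClosed.isBorelSet {A : Set E} (hA : IsClosed A) : IsBorelSet A := by
  rw [← compl_compl A]
  exact MeasurableSet.compl hA.isOpen_compl.isBorelSet

theorem isBorelSet_empty : IsBorelSet (∅ : Set E) := isOpen_empty.isBorelSet

theorem IsBorelSet.union {A B : Set E} (hA : IsBorelSet A) (hB : IsBorelSet B) :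
    IsBorelSet (A ∪ B) := MeasurableSet.union hA hB

theorem IsBorelSet.inter {A B : Set E} (hA : IsBorelSet A) (hB : IsBorelSet B) :
    IsBorelSet (A ∩ B) := MeasurableSet.inter hA hB

theorem IsBorelSet.diff {A B : Set E} (hA : IsBorelSet A) (hB : IsBorelSet B) :
    IsBorelSet (A \ B) := MeasurableSet.diff hA hB

theorem IsBorelSet.iUnion {ι : Sort*} [Countable ι] {A : ι → Set E}
    (hA : ∀ i, IsBorelSet (A i)) : IsBorelSet (⋃ i, A i) :=
  @MeasurableSet.iUnion E ι (BorelM E) _ A hA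

theorem IsBorelSet.iInter {ι : Sort*} [Countable ι] {A : ι → Set E}
    (hA : ∀ i, IsBorelSet (A i)) : IsBorelSet (⋂ i, A i) :=
  @MeasurableSet.iInter E ι (BorelM E) _ A hA

theorem IsBorelSet.accumulate {A : ℕ → Set E} (hA : ∀ n, IsBorelSet (A n)) (n : ℕ) :
    IsBorelSet (accumulate A n) := by
  rw [accumulate_def]
  exact IsBorelSet.iUnion fun i => IsBorelSet.iUnion fun _ => hA i

end BorelLemmas

section MaxitiveLemmas
variable {L : Type u} {E : Type v} [Lattice L] [OrderBot L] [TopologicalSpace E]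

theorem Maxitive.union {ν : Set E → L} (hν : Maxitive ν) {A B : Set E} (hA : IsBorelSet A)
    (hB : IsBorelSet B) : ν (A ∪ B) = ν A ⊔ ν B := by
  have h := hν.2 {A, B} (toFinite _) (by rintro C (rfl | rfl) <;> assumption)
  rw [sUnion_pair, image_pair] at h
  exact h.unique isLUB_pair

theorem Maxitive.mono {ν : Set E → L} (hν : Maxitive ν) {A B : Set E} (hA : IsBorelSet A)
    (hB : IsBorelSet B) (hAB : A ⊆ B) : ν A ≤ ν B := by
  have h := hν.union hA hB
  rw [union_eq_self_of_subset_left hAB] at h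
  exact h ▸ le_sup_left

theorem Maxitive.le_sup_of_subset {ν : Set E → L} (hν : Maxitive ν) {A B C : Set E}
    (hA : IsBorelSet A) (hB : IsBorelSet B) (hC : IsBorelSet C) (h : A ⊆ B ∪ C) :
    ν A ≤ ν B ⊔ ν C :=
  hν.union hB hC ▸ hν.mono hA (hB.union hC) h

theorem Maxitive.accumulate_le {ν : Set E → L} (hν : Maxitive ν) {f : ℕ → Set E}
    (hf : ∀ n, IsBorelSet (f n)) {u : L} (hu : ∀ n, ν (f n) ≤ u) (n : ℕ) :
    ν (accumulate f n) ≤ u := by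
  induction n with
  | zero => simpa using hu 0
  | succ n ih =>
    rw [accumulate_succ, hν.union (.accumulate hf n) (hf _)]
    exact sup_le ih (hu _)

theorem maxitive_of_union {ν : Set E → L} (h0 : ν ∅ = ⊥)
    (h : ∀ A B, IsBorelSet A → IsBorelSet B → ν (A ∪ B) = ν A ⊔ ν B) : Maxitive ν := by
  refine ⟨h0, fun 𝒞 h𝒞 => ?_⟩
  suffices H : (∀ B ∈ 𝒞, IsBorelSet B) → IsBorelSet (⋃₀ 𝒞) ∧ IsLUB (ν '' 𝒞) (ν (⋃₀ 𝒞)) from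
    fun hB => (H hB).2
  induction 𝒞, h𝒞 using Set.Finite.induction_on with
  | empty => simp [h0, isBorelSet_empty]
  | @insert A 𝒟 _ _ ih =>
    intro hB
    have hA := hB A (mem_insert _ _)
    obtain ⟨h1, h2⟩ := ih fun B hB' => hB B (mem_insert_of_mem _ hB')
    rw [sUnion_insert, image_insert_eq, h _ _ hA h1]
    exact ⟨hA.union h1, h2.insert _⟩

theorem OptimalMeasure.exists_le_of_wayAbove {ν : Set E → L} (hν : OptimalMeasure ν)
    {B : ℕ → Set E} (hB : ∀ n, IsBorelSet (B n)) (hanti : Antitone B) (hempty : ⋂ n, B n = ∅)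
    {s : L} (hs : WayAbove s ⊥) : ∃ n, ν (B n) ≤ s := by
  have hglb := hν.2 B hB fun n => hanti n.le_succ
  rw [hempty, hν.1.1.1] at hglb
  refine hs {x | ∃ n, ν (B n) ≤ x} ⟨⟨⟨_, 0, le_rfl⟩, ?_⟩, ?_⟩ ⊥
    ⟨fun _ _ => bot_le, fun x hx => hglb.2 ?_⟩ le_rfl
  · rintro r ⟨m, hm⟩ t ⟨n, hn⟩
    refine ⟨ν (B (max m n)), ⟨_, le_rfl⟩, ?_, ?_⟩
    · exact (hν.1.1.mono (hB _) (hB _) (hanti (le_max_left m n))).trans hm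
    · exact (hν.1.1.mono (hB _) (hB _) (hanti (le_max_right m n))).trans hn
  · rintro r ⟨n, hn⟩ t hrt
    exact ⟨n, hn.trans hrt⟩
  · rintro _ ⟨n, rfl⟩
    exact hx ⟨n, le_rfl⟩

theorem OptimalMeasure.exists_diff_accumulate_le {ν : Set E → L} (hν : OptimalMeasure ν)
    {f : ℕ → Set E} (hf : ∀ n, IsBorelSet (f n)) {s : L} (hs : WayAbove s ⊥) :
    ∃ n, ν ((⋃ n, f n) \ accumulate f n) ≤ s := by
  refine hν.exists_le_of_wayAbove
    (fun n => (IsBorelSet.iUnion hf).diff (.accumulate hf n))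
    (fun m n hmn => sdiff_subset_sdiff_right (monotone_accumulate hmn)) ?_ hs
  rw [← sdiff_iUnion, iUnion_accumulate, sdiff_self]

/-- A maxitive measure dominated by an optimal measure is optimal. -/
theorem OptimalMeasure.of_le (hcont : ContinuousPoset L) {ν τ : Set E → L}
    (hν : OptimalMeasure ν) (hτ : Maxitive τ) (hle : ∀ B, IsBorelSet B → τ B ≤ ν B) :
    OptimalMeasure τ := by
  refine ⟨⟨hτ, fun 𝒞 hc hB => ?_⟩, fun B hB hanti => ?_⟩
  · rcases 𝒞.eq_empty_or_nonempty with rfl | hne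
    · simp [hτ.1]
    obtain ⟨f, rfl⟩ := hc.exists_eq_range hne
    have hf : ∀ n, IsBorelSet (f n) := fun n => hB _ (mem_range_self n)
    have hU : IsBorelSet (⋃ n, f n) := .iUnion hf
    rw [sUnion_range]
    refine ⟨?_, fun u hu => hcont.le_of_forall_wayAbove_bot fun s hs => ?_⟩
    · rintro _ ⟨_, ⟨n, rfl⟩, rfl⟩
      exact hτ.mono (hf n) hU (subset_iUnion f n)
    · obtain ⟨n, hn⟩ := hν.exists_diff_accumulate_le hf hs
      have hA : IsBorelSet (accumulate f n) := .accumulate hf n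
      have hD := hU.diff hA
      refine (hτ.le_sup_of_subset hU hA hD (by simp)).trans (sup_le_sup ?_ ?_)
      · exact hτ.accumulate_le hf (fun n => hu ⟨_, mem_range_self n, rfl⟩) n
      · exact (hle _ hD).trans hn
  · have hI : IsBorelSet (⋂ n, B n) := .iInter hB
    refine ⟨?_, fun t ht => hcont.le_of_forall_wayAbove_bot fun s hs => ?_⟩
    · rintro _ ⟨n, rfl⟩
      exact hτ.mono hI (hB n) (iInter_subset B n)
    · have hD n := (hB n).diff hI
      obtain ⟨n, hn⟩ := hν.exists_le_of_wayAbove hD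
        (fun m n hmn => sdiff_subset_sdiff_left (antitone_nat_of_succ_le hanti hmn))
        (by simp only [sdiff_eq, ← iInter_inter, inter_compl_self]) hs
      refine (ht (mem_range_self n)).trans
        ((hτ.le_sup_of_subset (hB n) hI (hD n) (by simp)).trans (sup_le_sup_left ?_ _))
      exact (hle _ (hD n)).trans hn

/-- The relative difference `a \ b` given by `sd` produces the least maxitive measure `τ`
with `ν = flo ⊔ τ`. -/
theorem exists_least_maxitive_complement (hcc : CondComplete L) {sd : L → L → L}
    (hsd : ∀ a b c : L, sd a b ≤ c ↔ a ≤ b ⊔ c) {ν φ : Set E → L} (hν : Maxitive ν)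
    (hφ : Maxitive φ) (hle : ∀ B, IsBorelSet B → φ B ≤ ν B) :
    ∃ τ : Set E → L, Maxitive τ ∧
      (∀ B, IsBorelSet B → IsLUB {l | ∃ C, IsBorelSet C ∧ C ⊆ B ∧ sd (ν C) (φ C) = l} (τ B)) ∧
      (∀ B, IsBorelSet B → ν B = φ B ⊔ τ B) := by
  have hbdd B (hB : IsBorelSet B) :
      ν B ∈ upperBounds {l | ∃ C, IsBorelSet C ∧ C ⊆ B ∧ sd (ν C) (φ C) = l} := by
    rintro _ ⟨C, hC, hCB, rfl⟩
    exact (hsd _ _ _).2 ((hν.mono hC hB hCB).trans le_sup_right)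
  have hex B : ∃ m, IsBorelSet B →
      IsLUB {l | ∃ C, IsBorelSet C ∧ C ⊆ B ∧ sd (ν C) (φ C) = l} m := by
    by_cases hB : IsBorelSet B
    · obtain ⟨m, hm⟩ := hcc {l | ∃ C, IsBorelSet C ∧ C ⊆ B ∧ sd (ν C) (φ C) = l}
        ⟨_, B, hB, Subset.rfl, rfl⟩ ⟨_, hbdd B hB⟩
      exact ⟨m, fun _ => hm⟩
    · exact ⟨⊥, fun h => absurd h hB⟩
  choose τ hτ using hex
  refine ⟨τ, maxitive_of_union ?_ fun A B hA hB => ?_, hτ, fun B hB => ?_⟩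
  · exact le_bot_iff.1 (((hτ ∅ isBorelSet_empty).2 (hbdd ∅ isBorelSet_empty)).trans hν.1.le)
  · have hmono {B'} (hB' : IsBorelSet B') (h : B' ⊆ A ∪ B) : τ B' ≤ τ (A ∪ B) := by
      refine (hτ B' hB').2 ?_
      rintro _ ⟨C, hC, hCB, rfl⟩
      exact (hτ _ (hA.union hB)).1 ⟨C, hC, hCB.trans h, rfl⟩
    refine le_antisymm ((hτ _ (hA.union hB)).2 ?_)
      (sup_le (hmono hA subset_union_left) (hmono hB subset_union_right))
    rintro _ ⟨C, hC, hCAB, rfl⟩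
    have key {B'} (hB' : IsBorelSet B') : ν (C ∩ B') ≤ φ C ⊔ τ B' :=
      ((hsd _ _ _).1 ((hτ B' hB').1 ⟨C ∩ B', hC.inter hB', inter_subset_right, rfl⟩)).trans
        (sup_le_sup_right (hφ.mono (hC.inter hB') hC inter_subset_left) _)
    rw [hsd]
    refine (hν.le_sup_of_subset hC (hC.inter hA) (hC.inter hB) ?_).trans (sup_le ?_ ?_)
    · rw [← inter_union_distrib_left]
      exact subset_inter Subset.rfl hCAB
    · exact (key hA).trans (sup_le_sup_left le_sup_left _)
    · exact (key hB).trans (sup_le_sup_left le_sup_right _)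
  · exact le_antisymm ((hsd _ _ _).1 ((hτ B hB).1 ⟨B, hB, Subset.rfl, rfl⟩))
      (sup_le (hle B hB) ((hτ B hB).2 (hbdd B hB)))

end MaxitiveLemmas

section MetrizableLemmas
variable {L : Type u} {E : Type v} [Lattice L] [OrderBot L] [TopologicalSpace E]
  [TopologicalSpace.MetrizableSpace E]

/-- Borel sets of a metrizable space are approximated by open and closed sets up to small
values of an optimal measure. -/
theorem OptimalMeasure.exists_isClosed_subset_isOpen {ν : Set E → L} (hν : OptimalMeasure ν)
    {s : L} (hs : WayAbove s ⊥) {B : Set E} (hB : IsBorelSet B) :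
    ∃ F G, IsClosed F ∧ IsOpen G ∧ F ⊆ B ∧ B ⊆ G ∧ ν (G \ F) ≤ s := by
  rw [IsBorelSet, borelM_eq_borel] at hB
  have hm := hν.1.1
  induction B, hB using MeasurableSpace.generateFrom_induction with
  | hC U hU _ =>
    have hU : IsOpen U := hU
    let _ := TopologicalSpace.metrizableSpaceMetric E
    obtain ⟨F, hFc, hFU, hFun, hFmono⟩ := hU.exists_iUnion_isClosed
    obtain ⟨n, hn⟩ := hν.exists_le_of_wayAbove
      (fun n => hU.isBorelSet.diff (hFc n).isBorelSet)
      (fun m n hmn => sdiff_subset_sdiff_right (hFmono hmn))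
      (by rw [← sdiff_iUnion, hFun, sdiff_self]) hs
    exact ⟨F n, U, hFc n, hU, hFU n, Subset.rfl, hn⟩
  | empty => exact ⟨∅, ∅, isClosed_empty, isOpen_empty, Subset.rfl, Subset.rfl, by simp [hm.1]⟩
  | compl A _ ih =>
    obtain ⟨F, G, hF, hG, hFA, hAG, h⟩ := ih
    refine ⟨Gᶜ, Fᶜ, hG.isClosed_compl, hF.isOpen_compl, compl_subset_compl.2 hAG,
      compl_subset_compl.2 hFA, ?_⟩
    rwa [compl_sdiff_compl]
  | iUnion A _ ih =>
    choose F G hF hG hFA hAG h using ih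
    have hFb n := (hF n).isBorelSet
    have hGb n := (hG n).isBorelSet
    have hFU : IsBorelSet (⋃ n, F n) := .iUnion hFb
    have hGU : IsBorelSet (⋃ n, G n) := .iUnion hGb
    obtain ⟨n, hn⟩ := hν.exists_diff_accumulate_le hFb hs
    have hacc : IsBorelSet (accumulate F n) := .accumulate hFb n
    refine ⟨accumulate F n, ⋃ n, G n, ?_, isOpen_iUnion hG,
      (accumulate_subset_iUnion n).trans (iUnion_mono hFA), iUnion_mono hAG, ?_⟩
    · rw [accumulate_def]
      exact (finite_Iic n).isClosed_biUnion fun i _ => hF i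
    have hGF : IsBorelSet (⋃ n, G n \ F n) := .iUnion fun n => (hGb n).diff (hFb n)
    refine (hm.le_sup_of_subset (hGU.diff hacc) hGF (hFU.diff hacc) ?_).trans (sup_le ?_ hn)
    · rintro x ⟨hx, hx'⟩
      by_cases hxF : x ∈ ⋃ n, F n
      · exact Or.inr ⟨hxF, hx'⟩
      · obtain ⟨k, hk⟩ := mem_iUnion.1 hx
        exact Or.inl (mem_iUnion.2 ⟨k, hk, fun h => hxF (mem_iUnion.2 ⟨k, h⟩)⟩)
    · rw [← sUnion_range]
      refine (hν.1.2 _ (countable_range _) ?_).2 ?_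
      · rintro _ ⟨n, rfl⟩
        exact (hGb n).diff (hFb n)
      · rintro _ ⟨_, ⟨n, rfl⟩, rfl⟩
        exact h n

theorem OptimalMeasure.outerContinuous (hcont : ContinuousPoset L) {ν : Set E → L}
    (hν : OptimalMeasure ν) : OuterContinuous ν := by
  refine fun B hB => ⟨?_, fun t ht => hcont.le_of_forall_wayAbove_bot fun s hs => ?_⟩
  · rintro _ ⟨G, hG, hBG, rfl⟩
    exact hν.1.1.mono hB hG.isBorelSet hBG
  · obtain ⟨F, G, hF, hG, hFB, hBG, h⟩ := hν.exists_isClosed_subset_isOpen hs hB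
    refine (ht ⟨G, hG, hBG, rfl⟩).trans ((hν.1.1.le_sup_of_subset hG.isBorelSet hB
      (hG.isBorelSet.diff hF.isBorelSet) ?_).trans (sup_le_sup_left h _))
    rw [← sdiff_subset_iff]
    exact sdiff_subset_sdiff_right hFB

/-- Inner approximation by compact sets, inside a fixed compact set. -/
theorem OptimalMeasure.inter_le_of_isCompact (hcont : ContinuousPoset L) {ν : Set E → L}
    (hν : OptimalMeasure ν) {K B : Set E} (hK : IsCompact K) (hB : IsBorelSet B) {u : L}
    (hu : ∀ C, IsCompact C → C ⊆ B → ν C ≤ u) : ν (K ∩ B) ≤ u := by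
  refine hcont.le_of_forall_wayAbove_bot fun s hs => ?_
  have hKB := hK.isClosed.isBorelSet.inter hB
  obtain ⟨F, G, hF, hG, hFB, hBG, h⟩ := hν.exists_isClosed_subset_isOpen hs hKB
  refine (hν.1.1.le_sup_of_subset hKB hF.isBorelSet (hG.isBorelSet.diff hF.isBorelSet) ?_).trans
    (sup_le_sup (hu F ?_ (hFB.trans inter_subset_right)) h)
  · rw [← sdiff_subset_iff]
    exact sdiff_subset_sdiff_left hBG
  · exact hK.of_isClosed_subset hF (hFB.trans inter_subset_left)

end MetrizableLemmas

/-- on a metrizable space, every optimal measure decomposes as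
`ν = ⌊ν⌋ ⊔ ⊥ν`, with `⌊ν⌋` a regular optimal measure and `⊥ν` an optimal measure
vanishing on compact Borel sets. -/
theorem stmt5 {L : Type u} {E : Type v} [Lattice L] [OrderBot L]
    [TopologicalSpace E] [TopologicalSpace.MetrizableSpace E]
    (hcc : CondComplete L) (hcont : ContinuousPoset L)
    (hdist : ∀ a b c : L, a ⊓ (b ⊔ c) = a ⊓ b ⊔ a ⊓ c)
    (ν νp flo : Set E → L) (hν : OptimalMeasure ν) (hνp : IsNuPlus ν νp)
    (hflo : RegPartRel νp flo) :
    ∃ bn : Set E → L, Maxitive bn ∧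
      (∀ B : Set E, IsBorelSet B → νp B = flo B ⊔ bn B) ∧
      (∀ τ : Set E → L, Maxitive τ → (∀ B : Set E, IsBorelSet B → νp B = flo B ⊔ τ B) →
        ∀ B : Set E, IsBorelSet B → bn B ≤ τ B) ∧
      RegularMeasure flo ∧ OptimalMeasure flo ∧ OptimalMeasure bn ∧
      (∀ K : Set E, IsBorelSet K → IsCompact K → bn K = ⊥) ∧
      (∀ B : Set E, IsBorelSet B → ν B = flo B ⊔ bn B) := by
  have hm := hν.1.1
  have hνp' : ∀ B, IsBorelSet B → νp B = ν B := fun B hB =>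
    (hνp B hB).unique (hν.outerContinuous hcont B hB)
  have hflo_ge {K B : Set E} (hB : IsBorelSet B) (hK : IsCompact K) (hKB : K ⊆ B) :
      ν K ≤ flo B := by
    have hKb := hK.isClosed.isBorelSet
    exact (hflo B hB).1 ⟨K, hKb, hK, hKB, hνp' K hKb⟩
  have hflo_le {B : Set E} (hB : IsBorelSet B) {u : L}
      (hu : ∀ K, IsCompact K → K ⊆ B → ν K ≤ u) : flo B ≤ u := by
    refine (hflo B hB).2 ?_
    rintro _ ⟨K, hKb, hK, hKB, rfl⟩
    exact (hνp' K hKb).le.trans (hu K hK hKB)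
  have hflo_ν B (hB : IsBorelSet B) : flo B ≤ ν B :=
    hflo_le hB fun K hK hKB => hm.mono hK.isClosed.isBorelSet hB hKB
  have hinter {K B : Set E} (hK : IsCompact K) (hB : IsBorelSet B) : ν (K ∩ B) ≤ flo B :=
    hν.inter_le_of_isCompact hcont hK hB fun C hC hCB => hflo_ge hB hC hCB
  have hflo_max : Maxitive flo := by
    refine maxitive_of_union ?_ fun A B hA hB => le_antisymm ?_ (sup_le ?_ ?_)
    · exact le_bot_iff.1 ((hflo_ν ∅ isBorelSet_empty).trans hm.1.le)
    · refine hflo_le (hA.union hB) fun K hK hKAB => ?_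
      have hKb := hK.isClosed.isBorelSet
      refine (hm.le_sup_of_subset hKb (hKb.inter hA) (hKb.inter hB) ?_).trans
        (sup_le_sup (hinter hK hA) (hinter hK hB))
      rw [← inter_union_distrib_left]
      exact subset_inter Subset.rfl hKAB
    · exact hflo_le hA fun K hK h => hflo_ge (hA.union hB) hK (h.trans subset_union_left)
    · exact hflo_le hB fun K hK h => hflo_ge (hA.union hB) hK (h.trans subset_union_right)
  have hflo_opt : OptimalMeasure flo := hν.of_le hcont hflo_max hflo_ν
  choose sd hsd using exists_forall_le_sup_iff hcc hcont hdist
  obtain ⟨bn, hbn, hlub, heq⟩ := exists_least_maxitive_complement hcc hsd hm hflo_max hflo_ν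
  refine ⟨bn, hbn, fun B hB => (hνp' B hB).trans (heq B hB), fun τ hτ hτeq B hB => ?_,
    ⟨fun B hB => ⟨?_, fun u hu => hflo_le hB fun K hK hKB => ?_⟩,
      hflo_opt.outerContinuous hcont⟩, hflo_opt,
    hν.of_le hcont hbn fun B hB => heq B hB ▸ le_sup_right, fun K hKb hK => ?_, heq⟩
  · refine (hlub B hB).2 ?_
    rintro _ ⟨C, hC, hCB, rfl⟩
    rw [hsd, ← hνp' C hC, hτeq C hC]
    exact sup_le_sup_left (hτ.mono hC hB hCB) _
  · rintro _ ⟨K, hKb, hK, hKB, rfl⟩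
    rw [satur_eq_self]
    exact hflo_max.mono hKb hB hKB
  · have hKb := hK.isClosed.isBorelSet
    refine (hflo_ge hKb hK Subset.rfl).trans (hu ⟨K, hKb, hK, hKB, ?_⟩)
    rw [satur_eq_self]
  · refine le_bot_iff.1 ((hlub K hKb).2 ?_)
    rintro _ ⟨C, hC, hCK, rfl⟩
    rw [hsd, sup_bot_eq]
    simpa [inter_eq_right.2 hCK] using hinter hK hC
end
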